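/- arXiv:1404.4832 — 2 statements merged into one kernel-verified Lean document; each statement's English description precedes it below -/
import Mathlib

section
/- Let m and k be positive integers with gcd(m,k)=1. Then the sum over primes q with q ≡ m (mod k) of 1/q^s tends to infinity as the real number s tends to 1 from above; in particular the series of reciprocals of the primes congruent to m modulo k diverges. -/
open Filter

open ArithmeticFunction ArithmeticFunction.vonMangoldt in
/-- The sum of the reciprocals of the primes in an invertible residue class diverges. -/
theorem not_summable_indicator_prime_eq_one_div {k : ℕ} [NeZero k] {a : ZMod k} (ha : IsUnit a) :
    ¬ Summable ({q : ℕ | q.Prime ∧ (q : ZMod k) = a}.indicator fun q : ℕ => 1 / (q : ℝ)) := by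
  intro hg
  set S := {q : ℕ | q.Prime ∧ (q : ZMod k) = a}
  set g : ℕ → ℝ := S.indicator fun q : ℕ => 1 / (q : ℝ) with hg_def
  have hg0 (n : ℕ) : 0 ≤ g n := Set.indicator_nonneg (fun _ _ => by positivity) n
  obtain ⟨C, hC⟩ := LSeries_residueClass_lower_bound ha
  set c : ℝ := (k.totient : ℝ)⁻¹
  have hc : 0 < c := inv_pos.mpr (mod_cast k.totient.pos_of_neZero)
  have hf := summable_residueClass_non_primes_div a
  set f : ℕ → ℝ := fun n => (if n.Prime then 0 else residueClass a n) / n with hf_def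
  have hf0 (n : ℕ) : 0 ≤ f n := by
    have := residueClass_nonneg a n
    simp only [hf_def]
    split_ifs <;> positivity
  obtain ⟨s, hs⟩ : ∃ s : Finset ℕ, ∑' n, g n - c / 2 < ∑ n ∈ s, g n :=
    (hg.hasSum.eventually_const_lt (by linarith)).exists
  set l : ℕ → ℝ := fun n => if n ∈ s then residueClass a n else 0 with hl_def
  set g' : ℕ → ℝ := fun n => if n ∈ s then g n else 0 with hg'_def
  have hl : HasSum l (∑ n ∈ s, residueClass a n) := by
    rw [← Finset.sum_congr rfl fun n hn => if_pos hn]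
    exact hasSum_sum_of_ne_finset_zero fun n hn => if_neg hn
  have hg' : HasSum g' (∑ n ∈ s, g n) := by
    rw [← Finset.sum_congr rfl fun n hn => if_pos hn]
    exact hasSum_sum_of_ne_finset_zero fun n hn => if_neg hn
  set K : ℝ := ∑' n, f n + ∑ n ∈ s, residueClass a n
  have key {x : ℝ} (hx : 1 < x) :
      ∑' n, residueClass a n / (n : ℝ) ^ x ≤ K + (x - 1)⁻¹ * (∑' n, g n - ∑ n ∈ s, g n) := by
    have hx' : 0 < x - 1 := sub_pos.mpr hx
    have hsum := (hf.hasSum.add hl).add ((hg.hasSum.sub hg').mul_left (x - 1)⁻¹)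
    have hle (n : ℕ) :
        residueClass a n / (n : ℝ) ^ x ≤ f n + l n + (x - 1)⁻¹ * (g n - g' n) := by
      have hl0 : 0 ≤ l n := by
        simp only [hl_def]; split_ifs <;> simp [residueClass_nonneg a n]
      have hg'0 : 0 ≤ (x - 1)⁻¹ * (g n - g' n) := by
        refine mul_nonneg (by positivity) ?_
        simp only [hg'_def]; split_ifs <;> simp [hg0]
      rcases n.eq_zero_or_pos with rfl | hn
      · rw [residueClass_apply_zero, zero_div]
        linarith [hf0 0]
      have hn1 : (1 : ℝ) ≤ n := mod_cast hn
      have hpow : (n : ℝ) ≤ (n : ℝ) ^ x := by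
        simpa using Real.rpow_le_rpow_of_exponent_le hn1 hx.le
      by_cases hp : n.Prime
      swap
      · have : residueClass a n / (n : ℝ) ^ x ≤ f n := by
          simp only [hf_def, if_neg hp]
          exact div_le_div_of_nonneg_left (residueClass_nonneg a n) (by linarith) hpow
        linarith
      by_cases hns : n ∈ s
      · have : residueClass a n / (n : ℝ) ^ x ≤ l n := by
          simp only [hl_def, if_pos hns]
          exact div_le_self (residueClass_nonneg a n) (hn1.trans hpow)
        linarith [hf0 n]
      have : residueClass a n / (n : ℝ) ^ x ≤ (x - 1)⁻¹ * (g n - g' n) := by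
        by_cases hna : (n : ZMod k) = a
        swap
        · have hna0 : residueClass a n = 0 := by simp [residueClass, hna]
          rwa [hna0, zero_div]
        have hnS : n ∈ S := ⟨hp, hna⟩
        have hn0 : (0 : ℝ) < n := by linarith
        have hlog : residueClass a n = Real.log n := by
          simp [residueClass, hna, vonMangoldt_apply_prime hp]
        simp only [hg'_def, if_neg hns, hg_def, Set.indicator_of_mem hnS, sub_zero]
        rw [hlog, div_le_iff₀ (by positivity)]
        calc Real.log n ≤ (n : ℝ) ^ (x - 1) / (x - 1) := Real.log_le_rpow_div hn0.le hx'
          _ = (x - 1)⁻¹ * (1 / (n : ℝ)) * (n : ℝ) ^ x := by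
            rw [Real.rpow_sub_one hn0.ne']
            field_simp
      linarith [hf0 n]
    have hR0 (n : ℕ) : 0 ≤ residueClass a n / (n : ℝ) ^ x :=
      div_nonneg (residueClass_nonneg a n) (by positivity)
    exact hasSum_le hle (hsum.summable.of_nonneg_of_le hR0 hle).hasSum hsum
  have bound {y : ℝ} (hy : 1 ≤ y) : c / 2 * y ≤ K + C := by
    have hy0 : 0 < y := by linarith
    have h1 := hC (x := 1 + y⁻¹)
      ⟨by linarith [inv_pos.mpr hy0], by linarith [inv_le_one_of_one_le₀ hy]⟩
    have h2 := key (x := 1 + y⁻¹) (by linarith [inv_pos.mpr hy0])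
    simp only [add_sub_cancel_left, inv_inv, div_inv_eq_mul] at h1 h2
    nlinarith
  obtain ⟨y, hy, hy'⟩ := ((eventually_ge_atTop 1).and
    ((tendsto_id.const_mul_atTop (half_pos hc)).eventually_gt_atTop (K + C))).exists
  exact (bound hy).not_gt hy'

/-- Over a set of positive integers on which the reciprocals have divergent sum, the Dirichlet
series tends to infinity at `1` from the right. -/
theorem tendsto_tsum_one_div_rpow_atTop {P : ℕ → Prop} (h0 : ∀ n, P n → n ≠ 0)
    (hP : ¬ Summable fun n : {n // P n} => 1 / ((n : ℕ) : ℝ)) :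
    Tendsto (fun s : ℝ => ∑' n : {n // P n}, 1 / ((n : ℕ) : ℝ) ^ s)
      (nhdsWithin 1 (Set.Ioi 1)) atTop := by
  rw [tendsto_atTop]
  intro B
  obtain ⟨t, ht⟩ : ∃ t : Finset {n // P n}, B < ∑ n ∈ t, 1 / ((n : ℕ) : ℝ) := by
    by_contra! H
    exact hP (summable_of_sum_le (fun _ => by positivity) H)
  have hcont : ContinuousAt (fun s : ℝ => ∑ n ∈ t, 1 / ((n : ℕ) : ℝ) ^ s) 1 := by
    refine tendsto_finsetSum _ fun n _ => ?_
    have hn : ((n : ℕ) : ℝ) ≠ 0 := mod_cast h0 n n.2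
    exact continuousAt_const.div (Real.continuousAt_const_rpow hn)
      (Real.rpow_pos_of_pos (by positivity) _).ne'
  have hev : ∀ᶠ s in nhds (1 : ℝ), B < ∑ n ∈ t, 1 / ((n : ℕ) : ℝ) ^ s :=
    hcont.eventually_const_lt (by simpa using ht)
  filter_upwards [nhdsWithin_le_nhds hev, self_mem_nhdsWithin] with s hs hs1
  have hsum : Summable fun n : {n // P n} => 1 / ((n : ℕ) : ℝ) ^ s :=
    (Real.summable_one_div_nat_rpow.mpr hs1).comp_injective Subtype.val_injective
  exact hs.le.trans (hsum.sum_le_tsum t fun _ _ => by positivity)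

/-- Quantitative form of Dirichlet's theorem: for coprime positive integers `m`, `k`,
the sum over primes `q ≡ m (mod k)` of `1/q^s` tends to infinity as `s → 1⁺`;
in particular the series of reciprocals of these primes diverges. -/
theorem stmt1 (m k : ℕ) (hm : 0 < m) (hk : 0 < k) (h : Nat.gcd m k = 1) :
    Tendsto
      (fun s : ℝ => ∑' q : {q : ℕ // q.Prime ∧ q ≡ m [MOD k]}, 1 / ((q : ℕ) : ℝ) ^ s)
      (nhdsWithin 1 (Set.Ioi 1)) atTop ∧
    ¬ Summable (fun q : {q : ℕ // q.Prime ∧ q ≡ m [MOD k]} => 1 / ((q : ℕ) : ℝ)) := by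
  have : NeZero k := ⟨hk.ne'⟩
  have hdiv : ¬ Summable (fun q : {q : ℕ // q.Prime ∧ q ≡ m [MOD k]} => 1 / ((q : ℕ) : ℝ)) := by
    have := not_summable_indicator_prime_eq_one_div ((ZMod.isUnit_iff_coprime m k).mpr h)
    simp only [ZMod.natCast_eq_natCast_iff] at this
    exact fun H => this (summable_subtype_iff_indicator.mp H)
  exact ⟨tendsto_tsum_one_div_rpow_atTop (fun _ hq => hq.1.ne_zero) hdiv, hdiv⟩
end

section
/- Let χ be a nonprincipal Dirichlet character modulo k. Then L(1,χ) = ∑_{n=1}^∞ χ(n)/n is a nonzero complex number. -/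
open Filter

/-- Summation by parts over `Finset.range N`. -/
lemma sum_range_mul_by_parts {R : Type*} [CommRing R] (f g : ℕ → R) (N : ℕ) :
    ∑ i ∈ Finset.range N, f i * g i = (∑ j ∈ Finset.range N, f j) * g N +
      ∑ i ∈ Finset.range N, (∑ j ∈ Finset.range (i + 1), f j) * (g i - g (i + 1)) := by
  induction N with
  | zero => simp
  | succ N ih =>
    rw [Finset.sum_range_succ, ih,
      Finset.sum_range_succ (fun i => (∑ j ∈ Finset.range (i + 1), f j) * (g i - g (i + 1))) N,
      Finset.sum_range_succ f N]
    ring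

lemma sum_range_zmod_add {M : Type*} [AddCommMonoid M] {k : ℕ} [NeZero k] (f : ZMod k → M)
    (a : ZMod k) : ∑ i ∈ Finset.range k, f (a + i) = ∑ x, f x := by
  rw [← Equiv.sum_comp (Equiv.addLeft a) f]
  refine Finset.sum_bij (fun i _ => (i : ZMod k)) (by simp) (fun i hi j hj h => ?_)
    (fun x _ => ⟨x.val, by simpa using x.val_lt, by simp⟩) (by simp)
  rw [Finset.mem_range] at hi hj
  simpa [ZMod.natCast_eq_natCast_iff', Nat.mod_eq_of_lt hi, Nat.mod_eq_of_lt hj] using h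

/-- The partial sums of a nonprincipal character mod `k` are bounded by `k`. -/
lemma norm_sum_range_dirichletCharacter_le {k : ℕ} [NeZero k] {χ : DirichletCharacter ℂ k}
    (hχ : χ ≠ 1) (N : ℕ) :
    ‖∑ n ∈ Finset.range N, χ ((n + 1 : ℕ) : ZMod k)‖ ≤ k := by
  have hper : Function.Periodic
      (fun N : ℕ => ∑ n ∈ Finset.range N, χ ((n + 1 : ℕ) : ZMod k)) k := by
    intro N
    have h : ∑ i ∈ Finset.range k, χ ((N + i + 1 : ℕ) : ZMod k) = 0 := by
      rw [← MulChar.sum_eq_zero_of_ne_one hχ, ← sum_range_zmod_add χ ((N + 1 : ℕ) : ZMod k)]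
      refine Finset.sum_congr rfl fun i _ => ?_
      push_cast
      ring_nf
    simp only [Finset.sum_range_add, h, add_zero]
  rw [← hper.map_mod_nat N]
  calc _ ≤ ∑ n ∈ Finset.range (N % k), (1 : ℝ) := norm_sum_le_of_le _ fun n _ => χ.norm_le_one _
    _ ≤ k := by simpa using (Nat.mod_lt N (NeZero.pos k)).le

lemma rpow_neg_sub_rpow_neg_le {s x : ℝ} (hs : 1 ≤ s) (hs' : s ≤ 2) (hx : 1 ≤ x) :
    |x ^ (-s) - (x + 1) ^ (-s)| ≤ 2 / x ^ 2 := by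
  have hx0 : 0 < x := by linarith
  rw [abs_of_nonneg (sub_nonneg.2 (Real.rpow_le_rpow_of_nonpos hx0 (by linarith) (by linarith)))]
  have h1 : (x + 1) ^ (-s) = x ^ (-s) * (x / (x + 1)) ^ s := by
    rw [Real.div_rpow hx0.le (by positivity), Real.rpow_neg hx0.le, Real.rpow_neg (by positivity)]
    field_simp
  have h2 : (x / (x + 1)) ^ 2 ≤ (x / (x + 1)) ^ s := by
    rw [← Real.rpow_two]
    exact Real.rpow_le_rpow_of_exponent_ge (by positivity)
      ((div_le_one (by positivity)).2 (by linarith)) hs'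
  have h3 : x ^ (-s) ≤ x⁻¹ := by
    rw [← Real.rpow_neg_one]
    exact Real.rpow_le_rpow_of_exponent_le hx (by linarith)
  have h4 : 0 ≤ 1 - (x / (x + 1)) ^ 2 := by
    rw [div_pow, sub_nonneg, div_le_one (by positivity)]
    nlinarith
  calc x ^ (-s) - (x + 1) ^ (-s) = x ^ (-s) * (1 - (x / (x + 1)) ^ s) := by rw [h1]; ring
    _ ≤ x ^ (-s) * (1 - (x / (x + 1)) ^ 2) := by gcongr
    _ ≤ x⁻¹ * (1 - (x / (x + 1)) ^ 2) := by gcongr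
    _ ≤ 2 / x ^ 2 := by
      rw [show x⁻¹ * (1 - (x / (x + 1)) ^ 2) = (2 * x + 1) / (x * (x + 1) ^ 2) by field_simp; ring,
        div_le_div_iff₀ (by positivity) (by positivity)]
      nlinarith [pow_pos hx0 2, pow_pos hx0 3]

lemma norm_sum_mul_rpow_neg_sub_le {f : ℕ → ℂ} {C : ℝ}
    (hf : ∀ N, ‖∑ n ∈ Finset.range N, f n‖ ≤ C) {s : ℝ} (hs : 1 ≤ s) (hs' : s ≤ 2) (i : ℕ) :
    ‖(∑ n ∈ Finset.range (i + 1), f n) *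
      ((((i + 1 : ℕ) : ℝ) ^ (-s) : ℝ) - (((i + 1 + 1 : ℕ) : ℝ) ^ (-s) : ℝ) : ℂ)‖ ≤
      C * (2 / ((i + 1 : ℕ) : ℝ) ^ 2) := by
  rw [norm_mul, ← Complex.ofReal_sub, Complex.norm_real, Real.norm_eq_abs]
  have h := rpow_neg_sub_rpow_neg_le hs hs' (x := ((i + 1 : ℕ) : ℝ)) (by simp)
  rw [← Nat.cast_add_one] at h
  exact mul_le_mul (hf _) h (abs_nonneg _) ((norm_nonneg _).trans (hf 0))

lemma summable_const_mul_two_div_sq (C : ℝ) :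
    Summable fun i : ℕ => C * (2 / ((i + 1 : ℕ) : ℝ) ^ 2) := by
  have h := (summable_nat_add_iff 1).2 (Real.summable_one_div_nat_pow.2 one_lt_two)
  refine ((h.mul_left 2).mul_left C).congr fun i => ?_
  ring

/-- A Dirichlet series with bounded coefficient sums converges at real `s ∈ [1, 2]`, to the sum
obtained by partial summation. -/
lemma tendsto_sum_mul_rpow_neg {f : ℕ → ℂ} {C : ℝ}
    (hf : ∀ N, ‖∑ n ∈ Finset.range N, f n‖ ≤ C) {s : ℝ} (hs : 1 ≤ s) (hs' : s ≤ 2) :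
    Tendsto (fun N => ∑ i ∈ Finset.range N, f i * ((((i + 1 : ℕ) : ℝ) ^ (-s) : ℝ) : ℂ)) atTop
      (nhds (∑' i : ℕ, (∑ n ∈ Finset.range (i + 1), f n) *
        ((((i + 1 : ℕ) : ℝ) ^ (-s) : ℝ) - (((i + 1 + 1 : ℕ) : ℝ) ^ (-s) : ℝ) : ℂ))) := by
  have hsum := (Summable.of_norm_bounded (summable_const_mul_two_div_sq C)
    (norm_sum_mul_rpow_neg_sub_le hf hs hs')).hasSum.tendsto_sum_nat
  have hlim : Tendsto (fun N : ℕ => (((N + 1 : ℕ) : ℝ) ^ (-s) : ℝ)) atTop (nhds 0) :=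
    (tendsto_rpow_neg_atTop (by linarith)).comp
      (tendsto_natCast_atTop_atTop.comp (tendsto_add_atTop_nat 1))
  have hzero : Tendsto (fun N : ℕ => (∑ n ∈ Finset.range N, f n) *
      ((((N + 1 : ℕ) : ℝ) ^ (-s) : ℝ) : ℂ)) atTop (nhds 0) := by
    refine squeeze_zero_norm (fun N => ?_) (mul_zero C ▸ hlim.const_mul C)
    rw [norm_mul, Complex.norm_real, Real.norm_of_nonneg (by positivity)]
    exact mul_le_mul_of_nonneg_right (hf N) (by positivity)
  refine ((hzero.add hsum).congr fun N => ?_).trans (by rw [zero_add])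
  exact (sum_range_mul_by_parts f (fun i => ((((i + 1 : ℕ) : ℝ) ^ (-s) : ℝ) : ℂ)) N).symm

lemma tendsto_tsum_mul_rpow_neg_sub {f : ℕ → ℂ} {C : ℝ}
    (hf : ∀ N, ‖∑ n ∈ Finset.range N, f n‖ ≤ C) :
    Tendsto (fun s : ℝ => ∑' i : ℕ, (∑ n ∈ Finset.range (i + 1), f n) *
        ((((i + 1 : ℕ) : ℝ) ^ (-s) : ℝ) - (((i + 1 + 1 : ℕ) : ℝ) ^ (-s) : ℝ) : ℂ))
      (nhdsWithin 1 (Set.Ioi 1))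
      (nhds (∑' i : ℕ, (∑ n ∈ Finset.range (i + 1), f n) *
        ((((i + 1 : ℕ) : ℝ) ^ (-1 : ℝ) : ℝ) - (((i + 1 + 1 : ℕ) : ℝ) ^ (-1 : ℝ) : ℝ) : ℂ))) := by
  refine tendsto_tsum_of_dominated_convergence (summable_const_mul_two_div_sq C)
    (fun i => ?_) ?_
  · have hcont (m : ℕ) : Tendsto (fun s : ℝ => ((((m + 1 : ℕ) : ℝ) ^ (-s) : ℝ) : ℂ))
        (nhdsWithin 1 (Set.Ioi 1)) (nhds ((((m + 1 : ℕ) : ℝ) ^ (-1 : ℝ) : ℝ) : ℂ)) := by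
      refine tendsto_nhdsWithin_of_tendsto_nhds (Complex.continuous_ofReal.tendsto _ |>.comp ?_)
      exact tendsto_const_nhds.rpow (continuous_neg.tendsto 1) (Or.inl (by positivity))
    exact ((hcont i).sub (hcont (i + 1))).const_mul _
  · filter_upwards [Ioo_mem_nhdsGT (one_lt_two : (1 : ℝ) < 2)] with s hs i
    exact norm_sum_mul_rpow_neg_sub_le hf hs.1.le hs.2.le i

lemma DirichletCharacter.tendsto_sum_rpow_neg_LFunction {k : ℕ} [NeZero k]
    (χ : DirichletCharacter ℂ k) {s : ℝ} (hs : 1 < s) :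
    Tendsto (fun N => ∑ i ∈ Finset.range N,
      χ ((i + 1 : ℕ) : ZMod k) * ((((i + 1 : ℕ) : ℝ) ^ (-s) : ℝ) : ℂ)) atTop
      (nhds (χ.LFunction s)) := by
  rw [χ.LFunction_eq_LSeries (by simpa using hs)]
  have h := (ZMod.LSeriesSummable_of_one_lt_re χ (s := s) (by simpa using hs)).LSeriesHasSum
  refine ((tendsto_add_atTop_iff_nat 1).2 h.tendsto_sum_nat).congr fun N => ?_
  rw [Finset.sum_range_succ', LSeries.term_zero, add_zero]
  refine Finset.sum_congr rfl fun i _ => ?_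
  rw [LSeries.term_of_ne_zero i.succ_ne_zero, Complex.ofReal_cpow (by positivity),
    Complex.ofReal_neg, Complex.cpow_neg, div_eq_mul_inv, Complex.ofReal_natCast]

/-- The series `∑ χ(n)/n` of a nonprincipal character converges to the value of its
`L`-function at `1`. -/
lemma DirichletCharacter.tendsto_sum_div_LFunction_one {k : ℕ} [NeZero k]
    {χ : DirichletCharacter ℂ k} (hχ : χ ≠ 1) :
    Tendsto (fun N : ℕ => ∑ n ∈ Finset.range N, χ ((n + 1 : ℕ) : ZMod k) / ((n + 1 : ℕ) : ℂ))
      atTop (nhds (χ.LFunction 1)) := by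
  have hf := norm_sum_range_dirichletCharacter_le hχ
  have hcont : Tendsto (fun s : ℝ => χ.LFunction s) (nhdsWithin 1 (Set.Ioi 1))
      (nhds (χ.LFunction 1)) := by
    refine tendsto_nhdsWithin_of_tendsto_nhds ?_
    simpa [Function.comp_def] using ((differentiable_LFunction hχ).continuous.comp
      Complex.continuous_ofReal).tendsto 1
  have hlim := hcont.congr' (by
    filter_upwards [Ioo_mem_nhdsGT (one_lt_two : (1 : ℝ) < 2)] with s hs
    exact tendsto_nhds_unique (χ.tendsto_sum_rpow_neg_LFunction hs.1)
      (tendsto_sum_mul_rpow_neg hf hs.1.le hs.2.le))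
  rw [tendsto_nhds_unique hlim (tendsto_tsum_mul_rpow_neg_sub hf)]
  refine (tendsto_sum_mul_rpow_neg hf le_rfl one_le_two).congr fun N => ?_
  refine Finset.sum_congr rfl fun i _ => ?_
  rw [Real.rpow_neg_one, Complex.ofReal_inv, Complex.ofReal_natCast, div_eq_mul_inv]

/-- Nonvanishing of `L(1,χ)` for a nonprincipal Dirichlet character `χ` mod `k`:
the series `∑_{n ≥ 1} χ(n)/n` converges to a nonzero complex number. -/
theorem stmt15 (k : ℕ) (hk : 0 < k) (χ : DirichletCharacter ℂ k) (hχ : χ ≠ 1) :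
    ∃ L : ℂ, L ≠ 0 ∧ Tendsto
      (fun N : ℕ => ∑ n ∈ Finset.range N, χ ((n + 1 : ℕ) : ZMod k) / ((n + 1 : ℕ) : ℂ))
      atTop (nhds L) := by
  have : NeZero k := ⟨hk.ne'⟩
  exact ⟨χ.LFunction 1, χ.LFunction_apply_one_ne_zero hχ,
    DirichletCharacter.tendsto_sum_div_LFunction_one hχ⟩
end
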